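/- arXiv:2108.04336 — 6 statements merged into one kernel-verified Lean document; each statement's English description precedes it below -/
import Mathlib

section
/- Let v ∈ f(K). If v is an extreme point of the convex hull conv(U), then v is a Pareto value of the multi-objective optimization problem. -/
open MvPolynomial Filter MeasureTheory

noncomputable section

/-- The feasible set `K` of the multi-objective optimization problem. -/
def mopK (n : ℕ) (E I : Finset ℕ) (c : ℕ → MvPolynomial (Fin n) ℝ) : Set (Fin n → ℝ) :=
  {x | (∀ i ∈ E, MvPolynomial.eval x (c i) = 0) ∧ ∀ j ∈ I, 0 ≤ MvPolynomial.eval x (c j)}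

/-- `xs` is a weakly Pareto point. -/
def isWPP {n m : ℕ} (K : Set (Fin n → ℝ)) (f : Fin m → MvPolynomial (Fin n) ℝ)
    (xs : Fin n → ℝ) : Prop :=
  xs ∈ K ∧ ¬ ∃ x ∈ K, ∀ i, MvPolynomial.eval x (f i) < MvPolynomial.eval xs (f i)

/-- `xs` is a Pareto point. -/
def isPP {n m : ℕ} (K : Set (Fin n → ℝ)) (f : Fin m → MvPolynomial (Fin n) ℝ)
    (xs : Fin n → ℝ) : Prop :=
  xs ∈ K ∧ ¬ ∃ x ∈ K, (∀ i, MvPolynomial.eval x (f i) ≤ MvPolynomial.eval xs (f i)) ∧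
      ∃ j, MvPolynomial.eval x (f j) < MvPolynomial.eval xs (f j)

/-- The epigraph set `U = f(K) + ℝ₊^m`. -/
def mopU {n m : ℕ} (K : Set (Fin n → ℝ)) (f : Fin m → MvPolynomial (Fin n) ℝ) :
    Set (Fin m → ℝ) :=
  {u | ∃ x ∈ K, ∀ i, MvPolynomial.eval x (f i) ≤ u i}

/-- For `v ∈ f(K)`, if `v` is an extreme point of `conv(U)`,
then `v` is a Pareto value. -/
theorem stmt_1 (n m : ℕ) (E I : Finset ℕ) (hEI : Disjoint E I)
    (c : ℕ → MvPolynomial (Fin n) ℝ) (f : Fin m → MvPolynomial (Fin n) ℝ)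
    (K : Set (Fin n → ℝ)) (hK : K = mopK n E I c)
    (v : Fin m → ℝ) (hv : ∃ x ∈ K, (fun i => MvPolynomial.eval x (f i)) = v)
    (hext : v ∈ Set.extremePoints ℝ (convexHull ℝ (mopU K f))) :
    ∃ xs, isPP K f xs ∧ (fun i => MvPolynomial.eval xs (f i)) = v := by
  obtain ⟨xs, hxs, rfl⟩ := hv
  refine ⟨xs, ⟨hxs, ?_⟩, rfl⟩
  rintro ⟨x, hx, hle, j, hj⟩
  let v : Fin m → ℝ := fun i => MvPolynomial.eval xs (f i)
  let w : Fin m → ℝ := fun i => MvPolynomial.eval x (f i)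
  have hw : w ∈ convexHull ℝ (mopU K f) :=
    subset_convexHull ℝ _ ⟨x, hx, fun _ => le_rfl⟩
  have hreflect : v + (v - w) ∈ convexHull ℝ (mopU K f) :=
    subset_convexHull ℝ _ ⟨xs, hxs, fun i => le_add_of_nonneg_right (sub_nonneg.2 (hle i))⟩
  have hmid : v ∈ openSegment ℝ w (v + (v - w)) := by
    refine ⟨1 / 2, 1 / 2, by norm_num, by norm_num, by norm_num, ?_⟩
    module
  have heq : w = v := (mem_extremePoints.1 hext).2 w hw _ hreflect hmid |>.1
  exact hj.ne (congrFun heq j)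
end
end

section
/- Let v ∈ f(K) and let w ∈ ℝ^m be a nonzero vector with w ≥ 0 such that wᵀu ≥ wᵀv for all u ∈ U, and set H = {u ∈ ℝ^m : wᵀu = wᵀv}. If a point u ∈ f(K) is a π-minimal point of H ∩ U for some permutation π of (1,...,m), then u is a Pareto value of the multi-objective optimization problem. -/
open MvPolynomial Filter MeasureTheory

noncomputable section

/-- The chain `T = T_0 ⊇ T_1 ⊇ ⋯ ⊇ T_m`: at step `k+1` we keep the vectors of `T_k`
whose `π(k+1)`-th entry is smallest. -/
def parChain (m : ℕ) (π : Equiv.Perm (Fin m)) (T : Set (Fin m → ℝ)) : ℕ → Set (Fin m → ℝ)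
  | 0 => T
  | k + 1 =>
    if h : k < m then
      {u ∈ parChain m π T k | ∀ w ∈ parChain m π T k, u (π ⟨k, h⟩) ≤ w (π ⟨k, h⟩)}
    else parChain m π T k

/-- `u` is a `π`-minimal point of `T`. -/
def isPiMinimal (m : ℕ) (π : Equiv.Perm (Fin m)) (T : Set (Fin m → ℝ)) (u : Fin m → ℝ) : Prop :=
  u ∈ parChain m π T m

/-- Every step of the chain of a set `T` is closed under passing to smaller elements of `T`. -/
theorem mem_parChain_of_le {m : ℕ} {π : Equiv.Perm (Fin m)} {T : Set (Fin m → ℝ)}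
    {u z : Fin m → ℝ} (hz : z ∈ T) (hzu : z ≤ u) {k : ℕ} (hu : u ∈ parChain m π T k) :
    z ∈ parChain m π T k := by
  induction k with
  | zero => exact hz
  | succ k ih =>
    unfold parChain at hu ⊢
    split_ifs at hu ⊢ with h
    · exact ⟨ih hu.1, fun y hy => (hzu _).trans (hu.2 y hy)⟩
    · exact ih hu

theorem parChain_antitone (m : ℕ) (π : Equiv.Perm (Fin m)) (T : Set (Fin m → ℝ)) :
    Antitone (parChain m π T) := by
  refine antitone_nat_of_succ_le fun k y hy => ?_
  unfold parChain at hy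
  split_ifs at hy with h
  · exact hy.1
  · exact hy

/-- A `π`-minimal point of `T` is minimal in `T` for the componentwise order. -/
theorem isPiMinimal.le_of_le {m : ℕ} {π : Equiv.Perm (Fin m)} {T : Set (Fin m → ℝ)}
    {u z : Fin m → ℝ} (hu : isPiMinimal m π T u) (hz : z ∈ T) (hzu : z ≤ u) : u ≤ z := by
  intro j
  obtain ⟨⟨k, hk⟩, rfl⟩ := π.surjective j
  have hsucc : u ∈ parChain m π T (k + 1) := parChain_antitone m π T hk hu
  have hzk : z ∈ parChain m π T k :=
    mem_parChain_of_le hz hzu (parChain_antitone m π T hk.le hu)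
  rw [parChain, dif_pos hk] at hsucc
  exact hsucc.2 z hzk

/-- If `H = {u : wᵀu = wᵀv}` is a supporting hyperplane of `U` through
`v ∈ f(K)` with nonzero normal `w ≥ 0`, and `u ∈ f(K)` is a `π`-minimal point of
`H ∩ U`, then `u` is a Pareto value. -/
theorem stmt_4 (n m : ℕ) (E I : Finset ℕ) (hEI : Disjoint E I)
    (c : ℕ → MvPolynomial (Fin n) ℝ) (f : Fin m → MvPolynomial (Fin n) ℝ)
    (K : Set (Fin n → ℝ)) (hK : K = mopK n E I c)
    (v : Fin m → ℝ) (hv : ∃ x ∈ K, (fun i => MvPolynomial.eval x (f i)) = v)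
    (w : Fin m → ℝ) (hw0 : w ≠ 0) (hw : ∀ i, 0 ≤ w i)
    (hsupp : ∀ u ∈ mopU K f, ∑ i, w i * v i ≤ ∑ i, w i * u i)
    (H : Set (Fin m → ℝ)) (hH : H = {u | ∑ i, w i * u i = ∑ i, w i * v i})
    (π : Equiv.Perm (Fin m))
    (u : Fin m → ℝ) (hu : ∃ x ∈ K, (fun i => MvPolynomial.eval x (f i)) = u)
    (hmin : isPiMinimal m π (H ∩ mopU K f) u) :
    ∃ xs, isPP K f xs ∧ (fun i => MvPolynomial.eval xs (f i)) = u := by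
  obtain ⟨xs, hxs, rfl⟩ := hu
  refine ⟨xs, ⟨hxs, ?_⟩, rfl⟩
  rintro ⟨x, hx, hle, j, hj⟩
  have hxU : (fun i => MvPolynomial.eval x (f i)) ∈ mopU K f := ⟨x, hx, fun _ => le_rfl⟩
  have huH : (fun i => MvPolynomial.eval xs (f i)) ∈ H :=
    (parChain_antitone m π _ m.zero_le hmin).1
  have hxH : (fun i => MvPolynomial.eval x (f i)) ∈ H := by
    rw [hH] at huH ⊢
    refine le_antisymm (le_trans ?_ (le_of_eq huH)) (hsupp _ hxU)
    exact Finset.sum_le_sum fun i _ => mul_le_mul_of_nonneg_left (hle i) (hw i)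
  exact (hmin.le_of_le ⟨hxH, hxU⟩ hle j).not_gt hj
end
end

section
/- Let v ∈ f(K) and let w ∈ ℝ^m be a nonzero vector with w ≥ 0 such that wᵀu ≥ wᵀv for all u ∈ U, and set H = {u ∈ ℝ^m : wᵀu = wᵀv}. If a point u ∈ f(K) is an extreme point of the set H ∩ U, then u is a Pareto value of the multi-objective optimization problem. -/
open MvPolynomial Filter MeasureTheory

noncomputable section

/-- If `H = {u : wᵀu = wᵀv}` is a supporting hyperplane of `U` through
`v ∈ f(K)` with nonzero normal `w ≥ 0`, and `u ∈ f(K)` is an extreme point of `H ∩ U`,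
then `u` is a Pareto value. -/
theorem stmt_5 (n m : ℕ) (E I : Finset ℕ) (hEI : Disjoint E I)
    (c : ℕ → MvPolynomial (Fin n) ℝ) (f : Fin m → MvPolynomial (Fin n) ℝ)
    (K : Set (Fin n → ℝ)) (hK : K = mopK n E I c)
    (v : Fin m → ℝ) (hv : ∃ x ∈ K, (fun i => MvPolynomial.eval x (f i)) = v)
    (w : Fin m → ℝ) (hw0 : w ≠ 0) (hw : ∀ i, 0 ≤ w i)
    (hsupp : ∀ u ∈ mopU K f, ∑ i, w i * v i ≤ ∑ i, w i * u i)
    (H : Set (Fin m → ℝ)) (hH : H = {u | ∑ i, w i * u i = ∑ i, w i * v i})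
    (u : Fin m → ℝ) (hu : ∃ x ∈ K, (fun i => MvPolynomial.eval x (f i)) = u)
    (hext : u ∈ Set.extremePoints ℝ (H ∩ mopU K f)) :
    ∃ xs, isPP K f xs ∧ (fun i => MvPolynomial.eval xs (f i)) = u := by
  obtain ⟨x₀, hx₀, rfl⟩ := hu
  refine ⟨x₀, ⟨hx₀, ?_⟩, rfl⟩
  rintro ⟨x, hx, hle, j, hj⟩
  subst hH
  obtain ⟨⟨hmem, -⟩, hmid⟩ := hext
  simp only [Set.mem_ofPred_eq] at hmem
  have hzU : (fun i => MvPolynomial.eval x (f i)) ∈ mopU K f := ⟨x, hx, fun _ => le_rfl⟩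
  have hzH : ∑ i, w i * MvPolynomial.eval x (f i) = ∑ i, w i * v i :=
    le_antisymm
      (hmem ▸ Finset.sum_le_sum fun i _ => mul_le_mul_of_nonneg_left (hle i) (hw i))
      (hsupp _ hzU)
  -- the reflection of `f x` through `f x₀` dominates `f x₀`, so it also lies in `H ∩ U`
  have hyU : (fun i => 2 * MvPolynomial.eval x₀ (f i) - MvPolynomial.eval x (f i)) ∈ mopU K f :=
    ⟨x₀, hx₀, fun i => by linarith [hle i]⟩
  have hyH : ∑ i, w i * (2 * MvPolynomial.eval x₀ (f i) - MvPolynomial.eval x (f i)) =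
      ∑ i, w i * v i := by
    simp only [mul_sub, Finset.sum_sub_distrib, mul_left_comm _ (2 : ℝ), ← Finset.mul_sum]
    linarith
  have heq := hmid ⟨hzH, hzU⟩ ⟨hyH, hyU⟩
    ⟨1 / 2, 1 / 2, by norm_num, by norm_num, by norm_num, by
      ext i
      simp only [Pi.add_apply, Pi.smul_apply, smul_eq_mul]
      ring⟩
  exact hj.ne (congrFun heq j)
end
end

section
/- Assume K has nonempty interior and let d be the maximum degree of f_1,...,f_m. Define V = {v ∈ ℝ^m : there exists a Borel probability measure μ on ℝ^n with support contained in K, whose moments of order up to d are all finite, such that v_i > ∫ f_i dμ for every i = 1,...,m}. Then the interior of the convex hull conv(U) is equal to V. -/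
open MvPolynomial Filter MeasureTheory

noncomputable section

/-- The convex hull of an upper set is an upper set. -/
theorem isUpperSet_convexHull {m : ℕ} {S : Set (Fin m → ℝ)} (hS : IsUpperSet S) :
    IsUpperSet (convexHull ℝ S) := by
  have hsub : convexHull ℝ S ⊆ {u | ∀ v, u ≤ v → v ∈ convexHull ℝ S} := by
    refine convexHull_min (fun u hu v huv => subset_convexHull ℝ S (hS huv hu)) ?_
    intro x hx y hy a b ha hb hab v hv
    have hr : 0 ≤ v - (a • x + b • y) := sub_nonneg.2 hv
    have h := convex_convexHull ℝ S (hx _ (le_add_of_nonneg_right hr))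
      (hy _ (le_add_of_nonneg_right hr)) ha hb hab
    have he : a • (x + (v - (a • x + b • y))) + b • (y + (v - (a • x + b • y))) = v := by
      rw [smul_add, smul_add, add_add_add_comm, ← add_smul, hab, one_smul, add_sub_cancel]
    rwa [he] at h
  exact fun u v huv hu => hsub hu v huv

theorem isUpperSet_mopU {n m : ℕ} (K : Set (Fin n → ℝ)) (f : Fin m → MvPolynomial (Fin n) ℝ) :
    IsUpperSet (mopU K f) :=
  fun _ _ huv ⟨x, hx, hxu⟩ => ⟨x, hx, fun i => (hxu i).trans (huv i)⟩

/-- A polynomial is integrable once all monomials up to its degree are. -/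
theorem integrable_eval_of_moments {n d : ℕ} {μ : Measure (Fin n → ℝ)}
    (hμ : ∀ α : Fin n → ℕ, (∑ i, α i) ≤ d →
      Integrable (fun x : Fin n → ℝ => ∏ i, x i ^ α i) μ)
    {p : MvPolynomial (Fin n) ℝ} (hp : p.totalDegree ≤ d) :
    Integrable (fun x => MvPolynomial.eval x p) μ := by
  simp_rw [MvPolynomial.eval_eq']
  refine integrable_finsetSum _ fun s hs => (hμ s ?_).const_mul _
  refine le_trans (le_of_eq ?_) ((MvPolynomial.le_totalDegree hs).trans hp)
  rw [Finsupp.sum_fintype _ _ fun _ => rfl]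

/-- The vectors dominating the objective integrals of some probability measure on `K` with finite
moments up to order `d`. -/
def momentUpperImage {n m : ℕ} (K : Set (Fin n → ℝ)) (f : Fin m → MvPolynomial (Fin n) ℝ)
    (d : ℕ) : Set (Fin m → ℝ) :=
  {v | ∃ μ : Measure (Fin n → ℝ), IsProbabilityMeasure μ ∧ μ Kᶜ = 0 ∧
    (∀ α : Fin n → ℕ, (∑ i, α i) ≤ d →
      Integrable (fun x : Fin n → ℝ => ∏ i, x i ^ α i) μ) ∧
    ∀ i, (∫ x, MvPolynomial.eval x (f i) ∂μ) ≤ v i}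

theorem convex_momentUpperImage {n m : ℕ} (K : Set (Fin n → ℝ))
    (f : Fin m → MvPolynomial (Fin n) ℝ) {d : ℕ} (hd : ∀ i, (f i).totalDegree ≤ d) :
    Convex ℝ (momentUpperImage K f d) := by
  rintro x ⟨μ, hμ, hμK, hμm, hμx⟩ y ⟨ν, hν, hνK, hνm, hνy⟩ a b ha hb hab
  refine ⟨ENNReal.ofReal a • μ + ENNReal.ofReal b • ν, ⟨?_⟩, ?_, fun α hα => ?_, fun i => ?_⟩
  · simp [← ENNReal.ofReal_add ha hb, hab]
  · simp [hμK, hνK]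
  · exact ((hμm α hα).smul_measure ENNReal.ofReal_ne_top).add_measure
      ((hνm α hα).smul_measure ENNReal.ofReal_ne_top)
  · rw [integral_add_measure
        ((integrable_eval_of_moments hμm (hd i)).smul_measure ENNReal.ofReal_ne_top)
        ((integrable_eval_of_moments hνm (hd i)).smul_measure ENNReal.ofReal_ne_top),
      integral_smul_measure, integral_smul_measure, ENNReal.toReal_ofReal ha,
      ENNReal.toReal_ofReal hb]
    exact add_le_add (mul_le_mul_of_nonneg_left (hμx i) ha)
      (mul_le_mul_of_nonneg_left (hνy i) hb)

theorem mopU_subset_momentUpperImage {n m : ℕ} (K : Set (Fin n → ℝ))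
    (f : Fin m → MvPolynomial (Fin n) ℝ) (d : ℕ) : mopU K f ⊆ momentUpperImage K f d := by
  rintro u ⟨x, hx, hxu⟩
  refine ⟨Measure.dirac x, inferInstance, ?_, fun α _ => ?_, fun i => ?_⟩
  · rw [Measure.dirac_apply]
    simp [hx]
  · exact integrable_dirac (by simp)
  · rw [integral_dirac]
    exact hxu i

/-- The objective integrals of a probability measure on `K` lie in the closure of `conv(U)`. -/
theorem integral_eval_mem_closure_convexHull_mopU {n m : ℕ} {K : Set (Fin n → ℝ)}
    {f : Fin m → MvPolynomial (Fin n) ℝ} {μ : Measure (Fin n → ℝ)} [IsProbabilityMeasure μ]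
    (hμK : μ Kᶜ = 0) (hf : ∀ i, Integrable (fun x => MvPolynomial.eval x (f i)) μ) :
    (fun i => ∫ x, MvPolynomial.eval x (f i) ∂μ) ∈ closure (convexHull ℝ (mopU K f)) := by
  have hint : Integrable (fun x i => MvPolynomial.eval x (f i)) μ := Integrable.of_eval hf
  have hK : ∀ᵐ x ∂μ, x ∈ K := hμK
  have hmem : (∫ x, (fun i => MvPolynomial.eval x (f i)) ∂μ) ∈
      closure (convexHull ℝ (mopU K f)) := by
    refine (convex_convexHull ℝ _).closure.integral_mem isClosed_closure ?_ hint
    filter_upwards [hK] with x hx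
    exact subset_closure (subset_convexHull ℝ _ ⟨x, hx, fun i => le_rfl⟩)
  convert hmem using 1
  ext i
  rw [eval_integral hf]

/-- A vector strictly above a point of the closure of an upper set is interior to it. -/
theorem IsUpperSet.mem_interior_of_forall_lt_of_mem_closure {m : ℕ} {S : Set (Fin m → ℝ)}
    (hS : IsUpperSet S) {w v : Fin m → ℝ} (hw : w ∈ closure S) (hwv : ∀ i, w i < v i) :
    v ∈ interior S := by
  have hopen : IsOpen {u : Fin m → ℝ | ∀ i, w i < u i} := by
    simp only [Set.ofPred_forall]
    exact isOpen_iInter_of_finite fun i => isOpen_lt continuous_const (continuous_apply i)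
  refine mem_interior.2 ⟨_, fun u hu => ?_, hopen, hwv⟩
  have hbelow : IsOpen {z : Fin m → ℝ | ∀ i, z i < u i} := by
    simp only [Set.ofPred_forall]
    exact isOpen_iInter_of_finite fun i => isOpen_lt (continuous_apply i) continuous_const
  obtain ⟨z, hzu, hzS⟩ := mem_closure_iff.1 hw _ hbelow hu
  exact hS (fun i => (hzu i).le) hzS

/-- An interior point stays in the set after lowering all coordinates by a small amount. -/
theorem exists_mem_forall_lt_of_mem_interior {m : ℕ} {S : Set (Fin m → ℝ)} {v : Fin m → ℝ}
    (hv : v ∈ interior S) : ∃ w ∈ S, ∀ i, w i < v i := by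
  have hcont : Continuous fun t : ℝ => fun i => v i - t := by fun_prop
  have hev : ∀ᶠ t : ℝ in nhds 0, (fun i => v i - t) ∈ S :=
    hcont.continuousAt.eventually_mem (by simpa using mem_interior_iff_mem_nhds.1 hv)
  obtain ⟨t, htS, ht⟩ :=
    ((hev.filter_mono nhdsWithin_le_nhds).and (self_mem_nhdsWithin (s := Set.Ioi (0 : ℝ)))).exists
  exact ⟨_, htS, fun i => sub_lt_self _ ht⟩

/-- If `K` has nonempty interior and `d = max deg f_i`, then the interior
of `conv(U)` equals the set `V` of vectors `v` for which there is a Borel probability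
measure `μ` supported in `K` (i.e. `μ(Kᶜ) = 0`, `K` being closed), with all moments of
order up to `d` finite, such that `v_i > ∫ f_i dμ` for every `i`. -/
theorem stmt_7 (n m : ℕ) (E I : Finset ℕ) (hEI : Disjoint E I)
    (c : ℕ → MvPolynomial (Fin n) ℝ) (f : Fin m → MvPolynomial (Fin n) ℝ)
    (K : Set (Fin n → ℝ)) (hK : K = mopK n E I c)
    (hKint : (interior K).Nonempty)
    (d : ℕ) (hd : d = Finset.univ.sup fun i => (f i).totalDegree)
    (V : Set (Fin m → ℝ))
    (hV : V = {v | ∃ μ : Measure (Fin n → ℝ), IsProbabilityMeasure μ ∧ μ Kᶜ = 0 ∧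
      (∀ α : Fin n → ℕ, (∑ i, α i) ≤ d →
        Integrable (fun x : Fin n → ℝ => ∏ i, x i ^ α i) μ) ∧
      ∀ i, (∫ x, MvPolynomial.eval x (f i) ∂μ) < v i}) :
    interior (convexHull ℝ (mopU K f)) = V := by
  have hdeg : ∀ i, (f i).totalDegree ≤ d := fun i =>
    hd ▸ Finset.le_sup (f := fun i => (f i).totalDegree) (Finset.mem_univ i)
  subst hV
  refine Set.Subset.antisymm (fun v hv => ?_) ?_
  · obtain ⟨w, hw, hwv⟩ := exists_mem_forall_lt_of_mem_interior hv
    obtain ⟨μ, hμ, hμK, hμm, hμw⟩ := convexHull_min (mopU_subset_momentUpperImage K f d)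
      (convex_momentUpperImage K f hdeg) hw
    exact ⟨μ, hμ, hμK, hμm, fun i => (hμw i).trans_lt (hwv i)⟩
  · rintro v ⟨μ, hμ, hμK, hμm, hμv⟩
    exact (isUpperSet_convexHull (isUpperSet_mopU K f)).mem_interior_of_forall_lt_of_mem_closure
      (integral_eval_mem_closure_convexHull_mopU hμK fun i =>
        integrable_eval_of_moments hμm (hdeg i)) hμv
end
end

section
/- Let S be the set of minimizers of the min-max optimization problem min_{x∈K} max_{1≤i≤m} f_i(x). If x* ∈ S and f(x*) is a π-minimal point of the image set f(S) = {f(x) : x ∈ S} for some permutation π of (1,...,m), then x* is a Pareto point of the multi-objective optimization problem. -/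
open MvPolynomial Filter MeasureTheory

noncomputable section

/-- The min-max objective `max_{1 ≤ i ≤ m} f_i(x)` (requires `m > 0`). -/
def maxObj {n m : ℕ} (hm : 0 < m) (f : Fin m → MvPolynomial (Fin n) ℝ)
    (x : Fin n → ℝ) : ℝ :=
  Finset.univ.sup' (Finset.univ_nonempty_iff.mpr (Fin.pos_iff_nonempty.mp hm))
    fun i => MvPolynomial.eval x (f i)

theorem maxObj_mono {n m : ℕ} (hm : 0 < m) (f : Fin m → MvPolynomial (Fin n) ℝ)
    {x y : Fin n → ℝ} (h : ∀ i, MvPolynomial.eval x (f i) ≤ MvPolynomial.eval y (f i)) :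
    maxObj hm f x ≤ maxObj hm f y :=
  Finset.sup'_mono_fun fun i _ => h i

/-- A vector of `T` dominated by a member of the `k`-th set of the chain is itself a member of
that set, and agrees with the dominating vector in the first `k` entries selected by `π`. -/
theorem parChain_of_le {m : ℕ} {π : Equiv.Perm (Fin m)} {T : Set (Fin m → ℝ)}
    {u w : Fin m → ℝ} (hw : w ∈ T) (hwu : w ≤ u) {k : ℕ} (hu : u ∈ parChain m π T k) :
    w ∈ parChain m π T k ∧ ∀ i : Fin m, (i : ℕ) < k → w (π i) = u (π i) := by
  induction k with
  | zero => exact ⟨hw, fun i hi => absurd hi (Nat.not_lt_zero _)⟩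
  | succ k ih =>
    rw [parChain] at hu ⊢
    split_ifs at hu ⊢ with h
    · obtain ⟨huk, hle⟩ := hu
      obtain ⟨hwk, heq⟩ := ih huk
      refine ⟨⟨hwk, fun v hv => (hwu _).trans (hle v hv)⟩, fun i hi => ?_⟩
      rcases Nat.lt_succ_iff_lt_or_eq.mp hi with hi | rfl
      · exact heq i hi
      · exact le_antisymm (hwu _) (hle w hwk)
    · obtain ⟨hwk, heq⟩ := ih hu
      exact ⟨hwk, fun i _ => heq i (i.isLt.trans_le (not_lt.mp h))⟩

/-- Let `S` be the set of minimizers of `min_{x∈K} max_i f_i(x)`. If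
`x* ∈ S` and `f(x*)` is a `π`-minimal point of `f(S)` for some permutation `π`, then
`x*` is a Pareto point. -/
theorem stmt_14 (n m : ℕ) (hm : 0 < m) (E I : Finset ℕ) (hEI : Disjoint E I)
    (c : ℕ → MvPolynomial (Fin n) ℝ) (f : Fin m → MvPolynomial (Fin n) ℝ)
    (K : Set (Fin n → ℝ)) (hK : K = mopK n E I c)
    (S : Set (Fin n → ℝ))
    (hS : S = {x ∈ K | ∀ y ∈ K, maxObj hm f x ≤ maxObj hm f y})
    (xs : Fin n → ℝ) (hxs : xs ∈ S) (π : Equiv.Perm (Fin m))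
    (hmin : (fun i => MvPolynomial.eval xs (f i)) ∈
      parChain m π ((fun x => fun i => MvPolynomial.eval x (f i)) '' S) m) :
    isPP K f xs := by
  subst hS
  refine ⟨hxs.1, ?_⟩
  rintro ⟨x, hxK, hle, j, hj⟩
  have hx : x ∈ {x ∈ K | ∀ y ∈ K, maxObj hm f x ≤ maxObj hm f y} :=
    ⟨hxK, fun y hy => (maxObj_mono hm f hle).trans (hxs.2 y hy)⟩
  have heq := (parChain_of_le (Set.mem_image_of_mem _ hx) hle hmin).2 (π.symm j)
    (π.symm j).isLt
  rw [Equiv.apply_symm_apply] at heq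
  exact hj.ne heq
end
end

section
/- Let S be the set of minimizers of the min-max optimization problem min_{x∈K} max_{1≤i≤m} f_i(x). If S is nonempty and compact, then the multi-objective optimization problem has a Pareto point. -/
open MvPolynomial Filter MeasureTheory

noncomputable section

/-- Let `S` be the set of minimizers of `min_{x∈K} max_i f_i(x)`. If `S`
is nonempty and compact, then the multi-objective problem has a Pareto point. -/
theorem stmt_15 (n m : ℕ) (hm : 0 < m) (E I : Finset ℕ) (hEI : Disjoint E I)
    (c : ℕ → MvPolynomial (Fin n) ℝ) (f : Fin m → MvPolynomial (Fin n) ℝ)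
    (K : Set (Fin n → ℝ)) (hK : K = mopK n E I c)
    (S : Set (Fin n → ℝ))
    (hS : S = {x ∈ K | ∀ y ∈ K, maxObj hm f x ≤ maxObj hm f y})
    (hSne : S.Nonempty) (hScpt : IsCompact S) :
    ∃ xs, isPP K f xs := by
  subst hS
  have hcont : Continuous fun x : Fin n → ℝ => ∑ i, MvPolynomial.eval x (f i) :=
    continuous_finsetSum _ fun i _ => MvPolynomial.continuous_eval (f i)
  obtain ⟨xs, ⟨hxsK, hxsMin⟩, hsum⟩ := hScpt.exists_isMinOn hSne hcont.continuousOn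
  refine ⟨xs, hxsK, ?_⟩
  rintro ⟨x, hxK, hle, j, hlt⟩
  have hmax : maxObj hm f x ≤ maxObj hm f xs := Finset.sup'_mono_fun fun i _ => hle i
  have hxS : x ∈ {x ∈ K | ∀ y ∈ K, maxObj hm f x ≤ maxObj hm f y} :=
    ⟨hxK, fun y hy => hmax.trans (hxsMin y hy)⟩
  exact (Finset.sum_lt_sum (fun i _ => hle i) ⟨j, Finset.mem_univ j, hlt⟩).not_ge (hsum hxS)
end
end
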